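/- arXiv:1604.08234 — 2 statements merged into one kernel-verified Lean document; each statement's English description precedes it below -/
import Mathlib

section
/- Let (G,w) be an energy game and suppose there are d integer values w_1, ..., w_d and an integer window size δ ≥ 0 such that for every edge (u,v) ∈ E we have w(u,v) ∈ {w_i − δ, ..., w_i + δ} for some 1 ≤ i ≤ d. Define A' = {x − Σ_{j=1}^k w_{i_j} : 1 ≤ i_j ≤ d for all j, 0 ≤ k ≤ n, −nδ ≤ x ≤ nδ} ∪ {∞}. Then e*_{G,w}(v) ∈ A' for every node v ∈ V. -/
/-!
Common definitions for energy games (Brim et al. style), following the paper's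
definitions: a game graph is a finite directed graph in which every node has
out-degree at least one, together with a partition of the nodes into Alice's
nodes `VA` and Bob's nodes (the complement of `VA`).  Strategies are positional.
For a fixed pair of strategies the play from a node `s` is the orbit of the
induced successor function, and the minimal sufficient energy at `s` is the
least initial energy that keeps the running energy nonnegative forever, i.e.
`⨆ i, (-(weight of the length-i prefix))⁺ ∈ ℕ∞`; this coincides with
`∞` when the reachable cycle is negative and with `max (0, -min_P w(P))`
(minimum over simple paths `P` from `s`) otherwise.
-/

open scoped BigOperators

universe u

structure GameGraph (V : Type u) [Fintype V] [DecidableEq V] where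
  E : Finset (V × V)
  VA : Finset V
  exists_succ : ∀ v : V, ∃ u : V, (v, u) ∈ E

namespace GameGraph

variable {V : Type u} [Fintype V] [DecidableEq V]

/-- Positional strategies of Alice: a choice of an out-edge at every node of Alice. -/
def AliceStrategy (G : GameGraph V) : Type u :=
  {σ : V → V // ∀ u ∈ G.VA, (u, σ u) ∈ G.E}

/-- Positional strategies of Bob: a choice of an out-edge at every node of Bob. -/
def BobStrategy (G : GameGraph V) : Type u :=
  {τ : V → V // ∀ u : V, u ∉ G.VA → (u, τ u) ∈ G.E}

/-- The successor function of `G(σ,τ)`, the graph in which every node keeps only the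
out-edge chosen by its owner's strategy. -/
def play (G : GameGraph V) (σ : G.AliceStrategy) (τ : G.BobStrategy) (v : V) : V :=
  if v ∈ G.VA then σ.1 v else τ.1 v

/-- Total weight of the length-`i` prefix of the unique path from `s` in the
functional graph with successor function `f`. -/
def prefixWeight (w : V → V → ℤ) (f : V → V) (s : V) (i : ℕ) : ℤ :=
  ∑ j ∈ Finset.range i, w (f^[j] s) (f^[j + 1] s)

/-- The minimal sufficient energy `e*_{G(σ,τ),w}(s)` at `s` for a fixed pair of
strategies with induced successor function `f`:  the least initial energy
(in `ℕ∞ = ℤ≥0 ∪ {∞}`) keeping the running energy nonnegative forever.  It is `∞`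
iff the unique cycle reachable from `s` is negative, and `max (0, -min_P w(P))`
(minimum over simple paths from `s`) otherwise. -/
noncomputable def stratEnergy (w : V → V → ℤ) (f : V → V) (s : V) : ℕ∞ :=
  ⨆ i : ℕ, ((-(prefixWeight w f s i)).toNat : ℕ∞)

/-- The minimal sufficient energy `e*_{G,w}(s) = min_σ max_τ e*_{G(σ,τ),w}(s)`. -/
noncomputable def minEnergy (G : GameGraph V) (w : V → V → ℤ) (s : V) : ℕ∞ :=
  ⨅ σ : G.AliceStrategy, ⨆ τ : G.BobStrategy, stratEnergy w (G.play σ τ) s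

/-- Alice wins at `s` iff the minimal sufficient energy at `s` is finite. -/
noncomputable def AliceWins (G : GameGraph V) (w : V → V → ℤ) (s : V) : Prop :=
  G.minEnergy w s ≠ ⊤

/-- The canonical embedding `ℕ∞ = ℤ≥0 ∪ {∞} → ℤ ∪ {∞}` (extended arithmetic:
`∞ + x = ∞`, `∞ ≥ x`). -/
def toZInf (x : ℕ∞) : WithTop ℤ :=
  if x = ⊤ then ⊤ else ((x.toNat : ℤ) : WithTop ℤ)

/-- `max (x - z, 0)` for `x : ℕ∞` and `z : ℤ`, with `∞ - z = ∞`. -/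
def esub (x : ℕ∞) (z : ℤ) : ℕ∞ :=
  if x = ⊤ then ⊤ else ((((x.toNat : ℤ) - z).toNat : ℕ) : ℕ∞)

/-- The successors of `u` in `G`. -/
def succs (G : GameGraph V) (u : V) : Finset V :=
  (G.E.filter (fun p => p.1 = u)).image Prod.snd

/-- The weight function with every weight rounded up to the nearest multiple of `B`:
`w_B(u,v) = ⌈w(u,v)/B⌉·B`. -/
def roundW (w : V → V → ℤ) (B : ℤ) : V → V → ℤ :=
  fun u v => ⌈(w u v : ℚ) / (B : ℚ)⌉ * B

/-- `W = max_{(u,v) ∈ E} |w(u,v)|`. -/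
def maxAbsW (G : GameGraph V) (w : V → V → ℤ) : ℕ :=
  G.E.sup (fun p => (w p.1 p.2).natAbs)

/-- A strategy `τ` of Bob is optimal if `e*_{G(σ,τ),w}(s) ≥ e*_{G,w}(s)` for every
node `s` and every strategy `σ` of Alice. -/
noncomputable def IsOptimalBob (G : GameGraph V) (w : V → V → ℤ) (τ : G.BobStrategy) : Prop :=
  ∀ (s : V) (σ : G.AliceStrategy), G.minEnergy w s ≤ stratEnergy w (G.play σ τ) s

/-- Total weight of the cycle of length `L` through `x` in the functional graph `f`. -/
def cycleWeight (w : V → V → ℤ) (f : V → V) (x : V) (L : ℕ) : ℤ :=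
  ∑ j ∈ Finset.range L, w (f^[j] x) (f^[j + 1] x)

/-- A node `s` has penalty at least `D ≥ 0` if there is an optimal strategy `τ*` of Bob
such that for every strategy `σ` of Alice the unique cycle `C` reachable from `s` in
`G(σ,τ*)` satisfies: if `w(C) < 0` then the average weight `w(C)/|C|` is at most `-D`.
(The cycle is described by any node `x` on it, reachable from `s`, together with its
minimal period `L`.) -/
noncomputable def HasPenaltyAtLeast (G : GameGraph V) (w : V → V → ℤ) (s : V) (D : ℝ) : Prop :=
  ∃ τ : G.BobStrategy, G.IsOptimalBob w τ ∧
    ∀ σ : G.AliceStrategy, ∀ x : V, (∃ i : ℕ, (G.play σ τ)^[i] s = x) →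
      ∀ L : ℕ, 0 < L → (G.play σ τ)^[L] x = x →
        (∀ k : ℕ, 0 < k → k < L → (G.play σ τ)^[k] x ≠ x) →
        cycleWeight w (G.play σ τ) x L < 0 →
        ((cycleWeight w (G.play σ τ) x L : ℝ) / (L : ℝ) ≤ -D)

end GameGraph

namespace GameGraph

variable {V : Type u} [Fintype V] [DecidableEq V]

theorem play_mem (G : GameGraph V) (σ : G.AliceStrategy) (τ : G.BobStrategy) (u : V) :
    (u, G.play σ τ u) ∈ G.E := by
  unfold play
  split_ifs with h
  · exact σ.2 u h
  · exact τ.2 u h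

instance (G : GameGraph V) : Finite G.AliceStrategy :=
  inferInstanceAs (Finite {σ : V → V // ∀ u ∈ G.VA, (u, σ u) ∈ G.E})

instance (G : GameGraph V) : Finite G.BobStrategy :=
  inferInstanceAs (Finite {τ : V → V // ∀ u : V, u ∉ G.VA → (u, τ u) ∈ G.E})

instance (G : GameGraph V) : Nonempty G.AliceStrategy :=
  ⟨⟨fun u => (G.exists_succ u).choose, fun u _ => (G.exists_succ u).choose_spec⟩⟩

instance (G : GameGraph V) : Nonempty G.BobStrategy :=
  ⟨⟨fun u => (G.exists_succ u).choose, fun u _ => (G.exists_succ u).choose_spec⟩⟩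

/-- The minimum and maximum defining the minimal energy are attained. -/
theorem exists_minEnergy_eq (G : GameGraph V) (w : V → V → ℤ) (s : V) :
    ∃ (σ : G.AliceStrategy) (τ : G.BobStrategy),
      G.minEnergy w s = stratEnergy w (G.play σ τ) s := by
  obtain ⟨σ, hσ⟩ := exists_eq_ciInf_of_finite
    (f := fun σ : G.AliceStrategy => ⨆ τ : G.BobStrategy, stratEnergy w (G.play σ τ) s)
  obtain ⟨τ, hτ⟩ := exists_eq_ciSup_of_finite
    (f := fun τ : G.BobStrategy => stratEnergy w (G.play σ τ) s)
  exact ⟨σ, τ, hσ.symm.trans hτ.symm⟩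

theorem prefixWeight_succ {U : Type u} (w : U → U → ℤ) (f : U → U) (s : U) (i : ℕ) :
    prefixWeight w f s (i + 1) = prefixWeight w f s i + w (f^[i] s) (f^[i + 1] s) :=
  Finset.sum_range_succ _ _

/-- Once the path has entered a cycle of length `L`, its prefix weights grow by the same
amount over every period. -/
theorem prefixWeight_add_period {U : Type u} (w : U → U → ℤ) (f : U → U) (s : U) {a L : ℕ}
    (h : f^[a + L] s = f^[a] s) (m : ℕ) :
    prefixWeight w f s (a + m + L) - prefixWeight w f s (a + m) =
      prefixWeight w f s (a + L) - prefixWeight w f s a := by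
  have hper (j : ℕ) : f^[a + j + L] s = f^[a + j] s := by
    rw [show a + j + L = j + (a + L) by ring, Function.iterate_add_apply, h,
      ← Function.iterate_add_apply, add_comm]
  induction m with
  | zero => rfl
  | succ m ih =>
    have h₁ := hper m
    have h₂ := hper (m + 1)
    rw [show a + (m + 1) + L = a + m + L + 1 by ring] at h₂ ⊢
    rw [← add_assoc a m 1] at h₂ ⊢
    rw [prefixWeight_succ, prefixWeight_succ, h₁, h₂]
    linarith

/-- A finite energy of a fixed play is attained by a prefix of length less than the number of
nodes. -/
theorem exists_stratEnergy_eq (w : V → V → ℤ) (f : V → V) (s : V)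
    (hfin : stratEnergy w f s ≠ ⊤) :
    ∃ i ≤ Fintype.card V, ((stratEnergy w f s).toNat : ℤ) = -prefixWeight w f s i := by
  classical
  obtain ⟨N, hN⟩ := ENat.ne_top_iff_exists.mp hfin
  have hle (i : ℕ) : -prefixWeight w f s i ≤ N := by
    have h := le_iSup (fun i : ℕ => ((-(prefixWeight w f s i)).toNat : ℕ∞)) i
    change _ ≤ stratEnergy w f s at h
    rw [← hN] at h
    have h' : (-(prefixWeight w f s i)).toNat ≤ N := by exact_mod_cast h
    omega
  have hex : ∃ i, (N : ℤ) = -prefixWeight w f s i := by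
    rcases Nat.eq_zero_or_pos N with rfl | hpos
    · exact ⟨0, by simp [prefixWeight]⟩
    · obtain ⟨i, hi⟩ := ENat.exists_eq_iSup_of_lt_top (lt_top_iff_ne_top.mpr hfin)
      change _ = stratEnergy w f s at hi
      rw [← hN] at hi
      have hi' : (-(prefixWeight w f s i)).toNat = N := by exact_mod_cast hi
      exact ⟨i, by omega⟩
  refine ⟨Nat.find hex, ?_, ?_⟩
  · by_contra! hlt
    obtain ⟨a, b, hab, heq⟩ :=
      Fintype.exists_ne_map_eq_of_card_lt (fun j : Fin (Fintype.card V + 1) => f^[j] s) (by simp)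
    wlog hlt' : a < b generalizing a b
    · exact this b a hab.symm heq.symm (lt_of_le_of_ne (not_lt.mp hlt') hab.symm)
    have hab' : (a : ℕ) < b := hlt'
    have hb := b.isLt
    have hcyc : f^[a + (b - a : ℕ)] s = f^[a] s := by
      rw [Nat.add_sub_cancel' hab'.le]; exact heq.symm
    have h₁ := prefixWeight_add_period w f s hcyc (Nat.find hex - a)
    have h₂ := prefixWeight_add_period w f s hcyc (Nat.find hex - b)
    rw [show (a : ℕ) + (Nat.find hex - a) = Nat.find hex by omega] at h₁
    rw [show (a : ℕ) + (Nat.find hex - b) + (b - a) = Nat.find hex by omega] at h₂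
    have hmin := Nat.find_min hex (m := a + (Nat.find hex - b)) (by omega)
    have hspec := Nat.find_spec hex
    have := hle (Nat.find hex + (b - a))
    have := hle (a + (Nat.find hex - b))
    omega
  · rw [← hN]
    exact Nat.find_spec hex

/-- If there are `d` values `w_1, …, w_d` and a window size `δ ≥ 0` such that every
edge weight lies in `{w_i - δ, …, w_i + δ}` for some `i`, then every minimal energy
lies in `A' = {x - Σ_{j=1}^k w_{i_j} : 1 ≤ i_j ≤ d, 0 ≤ k ≤ n, -nδ ≤ x ≤ nδ} ∪ {∞}`. -/
theorem minimal_energy_mem_window_list (G : GameGraph V) (w : V → V → ℤ)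
    (d : ℕ) (wv : Fin d → ℤ) (δ : ℤ) (hδ : 0 ≤ δ)
    (hw : ∀ p ∈ G.E, ∃ i : Fin d, wv i - δ ≤ w p.1 p.2 ∧ w p.1 p.2 ≤ wv i + δ)
    (v : V) :
    G.minEnergy w v = ⊤ ∨
      ∃ k : ℕ, k ≤ Fintype.card V ∧ ∃ idx : Fin k → Fin d, ∃ x : ℤ,
        -((Fintype.card V : ℤ) * δ) ≤ x ∧ x ≤ (Fintype.card V : ℤ) * δ ∧
        toZInf (G.minEnergy w v) = ((x - ∑ j, wv (idx j) : ℤ) : WithTop ℤ) := by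
  rcases eq_or_ne (G.minEnergy w v) ⊤ with htop | hfin
  · exact Or.inl htop
  right
  obtain ⟨σ, τ, hστ⟩ := G.exists_minEnergy_eq w v
  rw [hστ] at hfin ⊢
  obtain ⟨k, hk, hval⟩ := exists_stratEnergy_eq w (G.play σ τ) v hfin
  set f := G.play σ τ
  have hedge (j : ℕ) : ∃ i : Fin d,
      wv i - δ ≤ w (f^[j] v) (f^[j + 1] v) ∧ w (f^[j] v) (f^[j + 1] v) ≤ wv i + δ := by
    rw [Function.iterate_succ_apply']
    exact hw _ (G.play_mem σ τ (f^[j] v))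
  choose idx hidx using hedge
  have hdev : |∑ j ∈ Finset.range k, (wv (idx j) - w (f^[j] v) (f^[j + 1] v))| ≤
      Fintype.card V * δ :=
    calc _ ≤ ∑ j ∈ Finset.range k, |wv (idx j) - w (f^[j] v) (f^[j + 1] v)| :=
          Finset.abs_sum_le_sum_abs _ _
      _ ≤ ∑ _j ∈ Finset.range k, δ := Finset.sum_le_sum fun j _ =>
          abs_le.mpr ⟨by linarith [(hidx j).2], by linarith [(hidx j).1]⟩
      _ = k * δ := by simp
      _ ≤ Fintype.card V * δ := by gcongr
  obtain ⟨hlow, hupp⟩ := abs_le.mp hdev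
  refine ⟨k, hk, fun j => idx j, _, hlow, hupp, ?_⟩
  rw [toZInf, if_neg hfin, hval, Finset.sum_sub_distrib, Finset.sum_range fun j => wv (idx j)]
  congr 1
  rw [prefixWeight]
  ring

end GameGraph
end

section
/- Let (G,w) be an energy game, let B > 0 be an integer, and let v be a node with penalty at least B. Then there exists an optimal strategy τ* of Bob such that for every strategy σ of Alice, e*_{G(σ,τ*),w}(v) = ∞ implies e*_{G(σ,τ*),w_B}(v) = ∞. -/
/-!
Common definitions for energy games (Brim et al. style), following the paper's
definitions: a game graph is a finite directed graph in which every node has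
out-degree at least one, together with a partition of the nodes into Alice's
nodes `VA` and Bob's nodes (the complement of `VA`).  Strategies are positional.
For a fixed pair of strategies the play from a node `s` is the orbit of the
induced successor function, and the minimal sufficient energy at `s` is the
least initial energy that keeps the running energy nonnegative forever, i.e.
`⨆ i, (-(weight of the length-i prefix))⁺ ∈ ℕ∞`; this coincides with
`∞` when the reachable cycle is negative and with `max (0, -min_P w(P))`
(minimum over simple paths `P` from `s`) otherwise.
-/

open scoped BigOperators

universe u

namespace GameGraph

variable {V : Type u} [Fintype V] [DecidableEq V]

theorem prefixWeight_add {α : Type*} (w : α → α → ℤ) (f : α → α) (s : α) (i m : ℕ) :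
    prefixWeight w f s (i + m) = prefixWeight w f s i + prefixWeight w f (f^[i] s) m := by
  unfold prefixWeight
  rw [Finset.sum_range_add]
  congr 1
  refine Finset.sum_congr rfl fun j _ => ?_
  rw [← Function.iterate_add_apply, ← Function.iterate_add_apply, Nat.add_comm j i,
    show i + j + 1 = j + 1 + i by omega]

theorem prefixWeight_mul_period {α : Type*} (w : α → α → ℤ) (f : α → α) {x : α} {L : ℕ}
    (hx : f^[L] x = x) (k : ℕ) :
    prefixWeight w f x (k * L) = k * prefixWeight w f x L := by
  induction k with
  | zero => simp [prefixWeight]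
  | succ k ih =>
    have hk : f^[k * L] x = x := by
      rw [Nat.mul_comm, Function.iterate_mul]
      exact Function.iterate_fixed hx k
    rw [Nat.succ_mul, prefixWeight_add, ih, hk]
    push_cast
    ring

theorem stratEnergy_eq_top_of_neg_cycle {α : Type*} (w : α → α → ℤ) (f : α → α) (s : α)
    {i L : ℕ}
    (hx : f^[L] (f^[i] s) = f^[i] s) (hneg : prefixWeight w f (f^[i] s) L < 0) :
    stratEnergy w f s = ⊤ := by
  rw [stratEnergy, ENat.iSup_natCast_eq_top]
  rintro ⟨b, hb⟩
  have h := hb ⟨i + (b + (prefixWeight w f s i).toNat + 1) * L, rfl⟩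
  simp only [prefixWeight_add, prefixWeight_mul_period w f hx] at h
  have h1 := Int.self_le_toNat (prefixWeight w f s i)
  rw [Int.toNat_le] at h
  push_cast at h
  nlinarith

theorem stratEnergy_ne_top_of_nonneg_cycle {α : Type*} (w : α → α → ℤ) (f : α → α) (s : α)
    {i L : ℕ}
    (hL : 0 < L) (hx : f^[L] (f^[i] s) = f^[i] s)
    (hnn : 0 ≤ prefixWeight w f (f^[i] s) L) :
    stratEnergy w f s ≠ ⊤ := by
  rw [stratEnergy, Ne, ENat.iSup_natCast_eq_top, not_not]
  refine ⟨(Finset.range (i + L)).sup fun n => (-prefixWeight w f s n).toNat, ?_⟩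
  rintro _ ⟨n, rfl⟩
  induction n using Nat.strong_induction_on with
  | _ n ih =>
    by_cases hn : n < i + L
    · exact Finset.le_sup (f := fun n => (-prefixWeight w f s n).toNat) (Finset.mem_range.2 hn)
    · obtain ⟨m, rfl⟩ := Nat.exists_eq_add_of_le (not_lt.1 hn)
      refine le_trans ?_ (ih (i + m) (by omega))
      refine Int.toNat_le_toNat ?_
      rw [Nat.add_assoc, prefixWeight_add, prefixWeight_add w f _ L m, hx,
        prefixWeight_add w f s i m]
      linarith

theorem roundW_lt_add {α : Type*} (w : α → α → ℤ) {B : ℤ} (hB : 0 < B) (u v : α) :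
    roundW w B u v < w u v + B := by
  have hB' : (0 : ℚ) < B := by exact_mod_cast hB
  have h := mul_lt_mul_of_pos_right (Int.ceil_lt_add_one ((w u v : ℚ) / B)) hB'
  rw [add_mul, div_mul_cancel₀ _ hB'.ne', one_mul] at h
  unfold roundW
  have h' : ((⌈(w u v : ℚ) / B⌉ * B : ℤ) : ℚ) < ((w u v + B : ℤ) : ℚ) := by
    simpa only [Int.cast_mul, Int.cast_add] using h
  exact Int.cast_lt.1 h'

theorem prefixWeight_roundW_lt {α : Type*} (w : α → α → ℤ) {B : ℤ} (hB : 0 < B) (f : α → α)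
    (x : α)
    {L : ℕ} (hL : 0 < L) :
    prefixWeight (roundW w B) f x L < prefixWeight w f x L + L * B := by
  have h := Finset.sum_lt_sum_of_nonempty (Finset.nonempty_range_iff.2 hL.ne')
    fun j _ => roundW_lt_add w hB (f^[j] x) (f^[j + 1] x)
  simpa [prefixWeight, Finset.sum_add_distrib] using h

/-- If a node `v` has penalty at least `B` for an integer `B > 0`, then there is an
optimal strategy `τ*` of Bob such that for every strategy `σ` of Alice,
`e*_{G(σ,τ*),w}(v) = ∞` implies `e*_{G(σ,τ*),w_B}(v) = ∞`, where
`w_B(u,v) = ⌈w(u,v)/B⌉·B`. -/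
theorem penalty_implies_rounding_condition (G : GameGraph V) (w : V → V → ℤ)
    (B : ℤ) (hB : 0 < B) (v : V)
    (hpen : G.HasPenaltyAtLeast w v (B : ℝ)) :
    ∃ τ : G.BobStrategy, G.IsOptimalBob w τ ∧
      ∀ σ : G.AliceStrategy,
        stratEnergy w (G.play σ τ) v = ⊤ →
        stratEnergy (roundW w B) (G.play σ τ) v = ⊤ := by
  obtain ⟨τ, hτ, hcyc⟩ := hpen
  refine ⟨τ, hτ, fun σ htop => ?_⟩
  set f := G.play σ τ
  obtain ⟨i, j, hij, heq⟩ : ∃ i j : ℕ, i < j ∧ f^[i] v = f^[j] v := by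
    obtain ⟨a, b, hab, h⟩ := Finite.exists_ne_map_eq_of_infinite fun n : ℕ => f^[n] v
    rcases hab.lt_or_gt with hlt | hlt
    · exact ⟨a, b, hlt, h⟩
    · exact ⟨b, a, hlt, h.symm⟩
  have hper : f^[j - i] (f^[i] v) = f^[i] v := by
    rw [← Function.iterate_add_apply, Nat.sub_add_cancel hij.le, heq]
  have hL := Function.IsPeriodicPt.minimalPeriod_pos (Nat.sub_pos_of_lt hij) hper
  have hx : f^[Function.minimalPeriod f (f^[i] v)] (f^[i] v) = f^[i] v :=
    Function.iterate_minimalPeriod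
  have hneg : prefixWeight w f (f^[i] v) (Function.minimalPeriod f (f^[i] v)) < 0 := by
    by_contra! h
    exact stratEnergy_ne_top_of_nonneg_cycle w f v hL hx h htop
  have havg := hcyc σ _ ⟨i, rfl⟩ _ hL hx
    (fun k hk hkL hkx => Function.not_isPeriodicPt_of_pos_of_lt_minimalPeriod hk.ne' hkL hkx) hneg
  refine stratEnergy_eq_top_of_neg_cycle _ f v hx ?_
  refine (prefixWeight_roundW_lt w hB f _ hL).trans_le ?_
  rw [div_le_iff₀ (by exact_mod_cast hL)] at havg
  have havg' : prefixWeight w f (f^[i] v) (Function.minimalPeriod f (f^[i] v)) ≤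
      -B * Function.minimalPeriod f (f^[i] v) := by exact_mod_cast havg
  linarith

end GameGraph
end
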